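/- Let s, t > 0 be real numbers with p := (s+1)/(s+t+2) and p̄ := (t+1)/(s+t+2). Let G = (V, E) be a finite simple graph and let y ∈ [0,1]^V be such that C := fr(y) is a clique in G. Then there exists z ∈ [0,1]^V such that (1) z_v = y_v for all v ∈ V ∖ C and |fr(z)| ≤ 1; and (2) f₂(z) ≥ f₂(y) and g₂(z) ≥ g₂(y). -/

import Mathlib

open Finset

/-- `f₀(x) = Σ_{uv ∈ E} x_u x_v - s Σ_{v ∈ V} x_v`, each edge counted once. -/
noncomputable def SimpleGraph.f0 {V : Type*} [Fintype V] (G : SimpleGraph V)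
    (s : ℝ) (x : V → ℝ) : ℝ :=
  letI := Classical.decEq V
  letI : DecidableRel G.Adj := Classical.decRel _
  (∑ e ∈ G.edgeFinset, Sym2.lift ⟨fun u v => x u * x v, fun _ _ => mul_comm _ _⟩ e)
    - s * ∑ v, x v

/-- `g₀(x) = Σ_{uv ∈ E} (1 - x_u)(1 - x_v) - t Σ_{v ∈ V} (1 - x_v)`, each edge counted once. -/
noncomputable def SimpleGraph.g0 {V : Type*} [Fintype V] (G : SimpleGraph V)
    (t : ℝ) (x : V → ℝ) : ℝ :=
  letI := Classical.decEq V
  letI : DecidableRel G.Adj := Classical.decRel _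
  (∑ e ∈ G.edgeFinset,
      Sym2.lift ⟨fun u v => (1 - x u) * (1 - x v), fun _ _ => mul_comm _ _⟩ e)
    - t * ∑ v, (1 - x v)

/-- The fractional support `fr(x) = {v : 0 < x_v < 1}` as a finset. -/
noncomputable def frSupport {V : Type*} [Fintype V] (x : V → ℝ) : Finset V :=
  Finset.univ.filter (fun v => 0 < x v ∧ x v < 1)

/-- `f₂(x) = f₀(x) - (Σ_C x_v - Σ_C y_v + p̄)²/2 - (Σ_C (x_v - x_v²))/2`,
where `C = fr(y)` and `p̄ = (t+1)/(s+t+2)`. -/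
noncomputable def SimpleGraph.f2 {V : Type*} [Fintype V] (G : SimpleGraph V)
    (s t : ℝ) (y : V → ℝ) (x : V → ℝ) : ℝ :=
  G.f0 s x
    - ((∑ v ∈ frSupport y, x v) - (∑ v ∈ frSupport y, y v) + (t + 1) / (s + t + 2)) ^ 2 / 2
    - (∑ v ∈ frSupport y, (x v - (x v) ^ 2)) / 2

/-- `g₂(x) = g₀(x) - (Σ_C x_v - Σ_C y_v + p)²/2 - (Σ_C (x_v - x_v²))/2`,
where `C = fr(y)` and `p = (s+1)/(s+t+2)`. -/
noncomputable def SimpleGraph.g2 {V : Type*} [Fintype V] (G : SimpleGraph V)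
    (s t : ℝ) (y : V → ℝ) (x : V → ℝ) : ℝ :=
  G.g0 t x
    - ((∑ v ∈ frSupport y, x v) - (∑ v ∈ frSupport y, y v) + (s + 1) / (s + t + 2)) ^ 2 / 2
    - (∑ v ∈ frSupport y, (x v - (x v) ^ 2)) / 2

open scoped Matrix

/-- Twice a sum over the edges is the quadratic form of the adjacency matrix. -/
lemma SimpleGraph.two_mul_sum_edgeFinset_mul {V : Type*} [Fintype V] [DecidableEq V]
    (G : SimpleGraph V) [DecidableRel G.Adj] (x : V → ℝ) :
    2 * ∑ e ∈ G.edgeFinset, Sym2.lift ⟨fun u v => x u * x v, fun _ _ => mul_comm _ _⟩ e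
      = x ⬝ᵥ G.adjMatrix ℝ *ᵥ x := by
  set F : Sym2 V → ℝ := Sym2.lift ⟨fun u v => x u * x v, fun _ _ => mul_comm _ _⟩ with hF
  have hdart : ∑ d : G.Dart, F d.edge = 2 * ∑ e ∈ G.edgeFinset, F e := by
    rw [← sum_fiberwise_of_maps_to (s := univ) (t := G.edgeFinset) (g := SimpleGraph.Dart.edge)
      (fun d _ => by simp [d.edge_mem]), mul_sum]
    refine sum_congr rfl fun e he => ?_
    rw [sum_congr rfl (g := fun _ => F e) (fun d hd => by rw [(mem_filter.1 hd).2]), sum_const,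
      G.dart_edge_fiber_card e (by simpa using he), nsmul_eq_mul, Nat.cast_ofNat]
  rw [← hdart, G.dotProduct_mulVec_adjMatrix, ← sum_product', ← sum_filter]
  refine sum_bij' (fun d _ => (d.fst, d.snd)) (fun p hp => ⟨p, (mem_filter.1 hp).2⟩) ?_ ?_ ?_ ?_ ?_
    <;> simp [hF, SimpleGraph.Dart.edge]

/-- The quadratic form of the adjacency matrix at a vector supported on a clique. -/
lemma SimpleGraph.dotProduct_adjMatrix_mulVec_of_isClique {V : Type*} [Fintype V] [DecidableEq V]
    (G : SimpleGraph V) [DecidableRel G.Adj] (d : V → ℝ) {C : Set V} (hC : G.IsClique C)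
    (hd : ∀ v ∉ C, d v = 0) :
    d ⬝ᵥ G.adjMatrix ℝ *ᵥ d = (∑ v, d v) ^ 2 - ∑ v, d v ^ 2 := by
  have hdiag : ∑ v, d v ^ 2 = ∑ u, ∑ v, if u = v then d u * d v else 0 := by
    simp [sq]
  rw [G.dotProduct_mulVec_adjMatrix, sq, sum_mul_sum, hdiag]
  simp only [← sum_sub_distrib]
  refine sum_congr rfl fun u _ => sum_congr rfl fun v _ => ?_
  rcases eq_or_ne u v with rfl | huv
  · simp
  by_cases hu : u ∈ C
  · by_cases hv : v ∈ C
    · simp [hC hu hv huv, huv]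
    · simp [hd v hv]
  · simp [hd u hu]

/-- The expansion of the quadratic form of the adjacency matrix around `y`. -/
lemma SimpleGraph.dotProduct_adjMatrix_mulVec_add {V : Type*} [Fintype V] [DecidableEq V]
    (G : SimpleGraph V) [DecidableRel G.Adj] (y d : V → ℝ) :
    (y + d) ⬝ᵥ G.adjMatrix ℝ *ᵥ (y + d)
      = y ⬝ᵥ G.adjMatrix ℝ *ᵥ y + 2 * ((G.adjMatrix ℝ *ᵥ y) ⬝ᵥ d)
        + d ⬝ᵥ G.adjMatrix ℝ *ᵥ d := by
  have hsymm : y ⬝ᵥ G.adjMatrix ℝ *ᵥ d = (G.adjMatrix ℝ *ᵥ y) ⬝ᵥ d := by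
    rw [Matrix.dotProduct_mulVec, ← Matrix.mulVec_transpose, G.transpose_adjMatrix]
  rw [Matrix.mulVec_add, add_dotProduct, dotProduct_add, dotProduct_add, hsymm,
    dotProduct_comm d (G.adjMatrix ℝ *ᵥ y)]
  ring

/-- A point strictly inside `[0, 1]` moving with non-zero speed stays in `[0, 1]` until it hits
an end point. -/
lemma exists_exit_time {a p : ℝ} (ha : 0 < a ∧ a < 1) (hp : p ≠ 0) :
    ∃ τ, 0 ≤ τ ∧ (a + τ * p = 0 ∨ a + τ * p = 1) ∧
      ∀ σ, 0 ≤ σ → σ ≤ τ → a + σ * p ∈ Set.Icc (0 : ℝ) 1 := by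
  rcases lt_or_gt_of_ne hp with h | h
  · have hτ : a / -p * p = -a := by field_simp
    refine ⟨a / -p, div_nonneg ha.1.le (by linarith), Or.inl (by linarith), fun σ h0 h1 => ?_⟩
    have := mul_le_mul_of_nonpos_right h1 h.le
    have := mul_nonpos_of_nonneg_of_nonpos h0 h.le
    constructor <;> linarith [ha.2]
  · have hτ : (1 - a) / p * p = 1 - a := by field_simp
    refine ⟨(1 - a) / p, div_nonneg (by linarith) h.le, Or.inr (by linarith), fun σ h0 h1 => ?_⟩
    have := mul_le_mul_of_nonneg_right h1 h.le
    have := mul_nonneg h0 h.le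
    constructor <;> linarith [ha.1]

/-- A point of the open unit square moving with non-zero velocity stays in the closed square until
it hits the boundary. -/
lemma exists_exit_time_square {a b p q : ℝ} (ha : 0 < a ∧ a < 1) (hb : 0 < b ∧ b < 1)
    (hpq : p ≠ 0 ∨ q ≠ 0) :
    ∃ τ, 0 ≤ τ ∧ a + τ * p ∈ Set.Icc (0 : ℝ) 1 ∧ b + τ * q ∈ Set.Icc (0 : ℝ) 1 ∧
      (a + τ * p = 0 ∨ a + τ * p = 1 ∨ b + τ * q = 0 ∨ b + τ * q = 1) := by
  rcases eq_or_ne p 0 with rfl | hp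
  · obtain ⟨τ, h0, h1, h2⟩ := exists_exit_time hb (hpq.resolve_left (by simp))
    exact ⟨τ, h0, by simp [ha.1.le, ha.2.le], h2 τ h0 le_rfl, by tauto⟩
  rcases eq_or_ne q 0 with rfl | hq
  · obtain ⟨τ, h0, h1, h2⟩ := exists_exit_time ha hp
    exact ⟨τ, h0, h2 τ h0 le_rfl, by simp [hb.1.le, hb.2.le], by tauto⟩
  obtain ⟨τ, h0, h1, h2⟩ := exists_exit_time ha hp
  obtain ⟨τ', h0', h1', h2'⟩ := exists_exit_time hb hq
  rcases le_total τ τ' with h | h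
  · exact ⟨τ, h0, h2 τ h0 le_rfl, h2' τ h0 h, by tauto⟩
  · exact ⟨τ', h0', h2 τ' h0' h, h2' τ' h0' le_rfl, by tauto⟩

/-- Two closed half-planes with the origin on their boundary share a non-zero vector. -/
lemma exists_ne_zero_common_halfPlane (a₁ a₂ b₁ b₂ : ℝ) :
    ∃ p q : ℝ, (p ≠ 0 ∨ q ≠ 0) ∧ 0 ≤ a₁ * p + a₂ * q ∧ 0 ≤ b₁ * p + b₂ * q := by
  by_cases h : a₁ = 0 ∧ a₂ = 0
  · obtain ⟨rfl, rfl⟩ := h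
    rcases le_total 0 b₁ with hb | hb
    · exact ⟨1, 0, by simp, by simp, by simpa⟩
    · exact ⟨-1, 0, by simp, by simp, by simpa⟩
  · have h' : a₂ ≠ 0 ∨ a₁ ≠ 0 := by tauto
    rcases le_total 0 (b₁ * a₂ - b₂ * a₁) with hb | hb
    · exact ⟨a₂, -a₁, by simpa using h', by linarith, by linarith⟩
    · exact ⟨-a₂, a₁, by simpa using h', by linarith, by linarith⟩

/-- A point of the cube can be moved, changing only fractional coordinates and without decreasing
two given linear functionals, to a point with at most one fractional coordinate. -/
lemma exists_rounding_of_linear {V : Type*} [Fintype V] (a b y : V → ℝ)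
    (hy : ∀ v, y v ∈ Set.Icc (0 : ℝ) 1) :
    ∃ z : V → ℝ, (∀ v, z v ∈ Set.Icc (0 : ℝ) 1) ∧
      (∀ v, v ∉ frSupport y → z v = y v) ∧ (frSupport z).card ≤ 1 ∧
      a ⬝ᵥ y ≤ a ⬝ᵥ z ∧ b ⬝ᵥ y ≤ b ⬝ᵥ z := by
  classical
  induction hn : (frSupport y).card using Nat.strong_induction_on generalizing y with
  | _ n ih =>
  subst hn
  by_cases hcard : (frSupport y).card ≤ 1
  · exact ⟨y, hy, fun _ _ => rfl, hcard, le_rfl, le_rfl⟩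
  obtain ⟨u, hu, v, hv, huv⟩ := one_lt_card.1 (not_le.1 hcard)
  have hu' : 0 < y u ∧ y u < 1 := by simpa [frSupport] using hu
  have hv' : 0 < y v ∧ y v < 1 := by simpa [frSupport] using hv
  obtain ⟨p, q, hpq, hpa, hpb⟩ := exists_ne_zero_common_halfPlane (a u) (a v) (b u) (b v)
  obtain ⟨τ, hτ, hτu, hτv, hexit⟩ := exists_exit_time_square hu' hv' hpq
  set w : V → ℝ := y + (Pi.single u (τ * p) + Pi.single v (τ * q)) with hw
  have hwu : w u = y u + τ * p := by simp [hw, huv]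
  have hwv : w v = y v + τ * q := by simp [hw, huv.symm]
  have hwo : ∀ x, x ≠ u → x ≠ v → w x = y x := fun x h1 h2 => by simp [hw, h1, h2]
  have hw_mem : ∀ x, w x ∈ Set.Icc (0 : ℝ) 1 := by
    intro x
    by_cases h1 : x = u
    · subst h1; rwa [hwu]
    by_cases h2 : x = v
    · subst h2; rwa [hwv]
    rw [hwo x h1 h2]; exact hy x
  have hsub : frSupport w ⊆ frSupport y := by
    intro x hx
    by_cases h1 : x = u
    · rwa [h1]
    by_cases h2 : x = v
    · rwa [h2]
    simpa [frSupport, hwo x h1 h2] using hx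
  have hne : frSupport w ≠ frSupport y := by
    intro h
    have h1 : 0 < w u ∧ w u < 1 := by rw [← h] at hu; simpa [frSupport] using hu
    have h2 : 0 < w v ∧ w v < 1 := by rw [← h] at hv; simpa [frSupport] using hv
    rw [hwu] at h1
    rw [hwv] at h2
    rcases hexit with h | h | h | h <;> linarith [h1.1, h1.2, h2.1, h2.2]
  have hval : ∀ c : V → ℝ, c ⬝ᵥ w = c ⬝ᵥ y + τ * (c u * p + c v * q) := fun c => by
    simp only [hw, dotProduct_add, dotProduct_single]
    ring
  obtain ⟨z, hz, hzy, hzc, hza, hzb⟩ :=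
    ih _ (card_lt_card (hsub.ssubset_of_ne hne)) w hw_mem rfl
  refine ⟨z, hz, fun x hx => ?_, hzc, ?_, ?_⟩
  · rw [hzy x fun h => hx (hsub h), hwo x (fun h => hx (h ▸ hu)) (fun h => hx (h ▸ hv))]
  · linarith [hval a, mul_nonneg hτ hpa]
  · linarith [hval b, mul_nonneg hτ hpb]

/-- The sum of the concave terms `x v - x v ^ 2` after a displacement supported on `C`, together
with the change of the sum of coordinates. -/
lemma sum_sub_sq_add {V : Type*} [Fintype V] (C : Finset V) (y d : V → ℝ)
    (hd : ∀ v ∉ C, d v = 0) :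
    ∑ v ∈ C, ((y + d) v - (y + d) v ^ 2)
      = ∑ v ∈ C, (y v - y v ^ 2) + ∑ v, d v - 2 * (y ⬝ᵥ d) - ∑ v, d v ^ 2 := by
  have hext : ∀ f : V → ℝ, (∀ v ∉ C, f v = 0) → ∑ v ∈ C, f v = ∑ v, f v := fun f hf =>
    sum_subset (subset_univ C) fun v _ hv => hf v hv
  rw [← hext d hd, ← hext (fun v => d v ^ 2) fun v hv => by simp [hd v hv], dotProduct,
    ← hext (fun v => y v * d v) fun v hv => by simp [hd v hv], mul_sum, ← sum_add_distrib,
    ← sum_sub_distrib, ← sum_sub_distrib]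
  refine sum_congr rfl fun v _ => ?_
  simp only [Pi.add_apply]
  ring

/-- `f₀` in terms of the quadratic form of the adjacency matrix. -/
lemma SimpleGraph.f0_eq {V : Type*} [Fintype V] [DecidableEq V] (G : SimpleGraph V)
    [DecidableRel G.Adj] (s : ℝ) (x : V → ℝ) :
    G.f0 s x = (x ⬝ᵥ G.adjMatrix ℝ *ᵥ x) / 2 - s * ∑ v, x v := by
  rw [← G.two_mul_sum_edgeFinset_mul, mul_div_cancel_left₀ _ two_ne_zero, SimpleGraph.f0]
  congr!

/-- `g₀` is `f₀` after the substitution `x ↦ 1 - x`. -/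
lemma SimpleGraph.g0_eq_f0 {V : Type*} [Fintype V] (G : SimpleGraph V) (t : ℝ) (x : V → ℝ) :
    G.g0 t x = G.f0 t (1 - x) := rfl

/-- The change of `f₀` along a displacement supported on a clique. -/
lemma SimpleGraph.f0_add {V : Type*} [Fintype V] [DecidableEq V] (G : SimpleGraph V)
    [DecidableRel G.Adj] (s : ℝ) (y d : V → ℝ) {C : Set V} (hC : G.IsClique C)
    (hd : ∀ v ∉ C, d v = 0) :
    G.f0 s (y + d) = G.f0 s y + (G.adjMatrix ℝ *ᵥ y) ⬝ᵥ d
      + ((∑ v, d v) ^ 2 - ∑ v, d v ^ 2) / 2 - s * ∑ v, d v := by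
  rw [G.f0_eq, G.f0_eq, G.dotProduct_adjMatrix_mulVec_add,
    G.dotProduct_adjMatrix_mulVec_of_isClique d hC hd]
  simp only [Pi.add_apply, sum_add_distrib]
  ring

/-- `f₂` is affine on displacements supported on the clique `fr(y)`. -/
lemma SimpleGraph.f2_add {V : Type*} [Fintype V] [DecidableEq V] (G : SimpleGraph V)
    [DecidableRel G.Adj] (s t : ℝ) (y d : V → ℝ) (hC : G.IsClique (frSupport y : Set V))
    (hd : ∀ v ∉ frSupport y, d v = 0) :
    G.f2 s t y (y + d) = G.f2 s t y y
      + (G.adjMatrix ℝ *ᵥ y + y + fun _ => -s - (t + 1) / (s + t + 2) - 1 / 2) ⬝ᵥ d := by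
  have hS : ∑ v ∈ frSupport y, d v = ∑ v, d v :=
    sum_subset (subset_univ _) fun v _ hv => hd v hv
  have hconst : ∀ c : ℝ, (fun _ => c) ⬝ᵥ d = c * ∑ v, d v := fun c => by
    simp [dotProduct, mul_sum]
  unfold SimpleGraph.f2
  rw [sum_sub_sq_add _ y d hd, G.f0_add s y d hC (by simpa using hd), add_dotProduct,
    add_dotProduct, hconst]
  simp only [Pi.add_apply, sum_add_distrib, hS]
  ring

/-- `g₂` is affine on displacements supported on the clique `fr(y)`. -/
lemma SimpleGraph.g2_add {V : Type*} [Fintype V] [DecidableEq V] (G : SimpleGraph V)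
    [DecidableRel G.Adj] (s t : ℝ) (y d : V → ℝ) (hC : G.IsClique (frSupport y : Set V))
    (hd : ∀ v ∉ frSupport y, d v = 0) :
    G.g2 s t y (y + d) = G.g2 s t y y
      + (-(G.adjMatrix ℝ *ᵥ (1 - y)) + y + fun _ => t - (s + 1) / (s + t + 2) - 1 / 2)
        ⬝ᵥ d := by
  have hS : ∑ v ∈ frSupport y, d v = ∑ v, d v :=
    sum_subset (subset_univ _) fun v _ hv => hd v hv
  have hconst : ∀ c : ℝ, (fun _ => c) ⬝ᵥ d = c * ∑ v, d v := fun c => by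
    simp [dotProduct, mul_sum]
  unfold SimpleGraph.g2
  rw [sum_sub_sq_add _ y d hd, G.g0_eq_f0, G.g0_eq_f0, show 1 - (y + d) = 1 - y + -d by abel,
    G.f0_add t (1 - y) (-d) hC (by simpa using hd), add_dotProduct, add_dotProduct, hconst,
    neg_dotProduct, dotProduct_neg]
  simp only [Pi.add_apply, Pi.neg_apply, sum_neg_distrib, neg_sq, sum_add_distrib, hS]
  ring

/-- If the fractional support `C = fr(y)` of `y ∈ [0,1]^V` is a clique, then there is
`z ∈ [0,1]^V` agreeing with `y` outside `C`, with at most one fractional coordinate,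
such that `f₂(z) ≥ f₂(y)` and `g₂(z) ≥ g₂(y)`. -/
theorem exists_rounding_on_clique {V : Type*} [Fintype V]
    (G : SimpleGraph V) (s t : ℝ) (hs : 0 < s) (ht : 0 < t)
    (y : V → ℝ) (hy : ∀ v, y v ∈ Set.Icc (0 : ℝ) 1)
    (hC : G.IsClique {v | 0 < y v ∧ y v < 1}) :
    ∃ z : V → ℝ, (∀ v, z v ∈ Set.Icc (0 : ℝ) 1) ∧
      (∀ v, v ∉ frSupport y → z v = y v) ∧ (frSupport z).card ≤ 1 ∧
      G.f2 s t y y ≤ G.f2 s t y z ∧ G.g2 s t y y ≤ G.g2 s t y z := by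
  classical
  have hC' : G.IsClique (frSupport y : Set V) := by simpa [frSupport] using hC
  obtain ⟨z, hz, hzy, hcard, hf, hg⟩ := exists_rounding_of_linear
    (G.adjMatrix ℝ *ᵥ y + y + fun _ => -s - (t + 1) / (s + t + 2) - 1 / 2)
    (-(G.adjMatrix ℝ *ᵥ (1 - y)) + y + fun _ => t - (s + 1) / (s + t + 2) - 1 / 2) y hy
  have hd : ∀ v ∉ frSupport y, (z - y) v = 0 := fun v hv => by simp [hzy v hv]
  have hF := G.f2_add s t y (z - y) hC' hd
  have hG := G.g2_add s t y (z - y) hC' hd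
  rw [add_sub_cancel, dotProduct_sub] at hF hG
  exact ⟨z, hz, hzy, hcard, by linarith, by linarith⟩
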